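/- arXiv:2411.17780 — 3 statements merged into one kernel-verified Lean document; each statement's English description precedes it below -/
import Mathlib

section
/- Let s be a prime, k = s^m a prime power with k + 1 = 2p for a prime p, and suppose 10 divides k - 1. Let X be a connected simple graph whose automorphism group contains a subgroup G isomorphic to PSL(2, k) acting transitively on the vertices of X, such that the stabilizer in G of a vertex is isomorphic to the semidirect product (Z_s)^m ⋊ Z_{(k-1)/10}. Then X contains a Hamilton cycle. -/
open scoped MatrixGroups

/-- The natural monoid homomorphism from graph automorphisms to permutations of the vertices. -/
def autToPerm {V : Type*} (X : SimpleGraph V) : (X ≃g X) →* Equiv.Perm V where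
  toFun g := g.toEquiv
  map_one' := rfl
  map_mul' _ _ := rfl

/-- A closed sequence of adjacent vertices without repetitions that exhausts the vertex set yields
a Hamilton cycle. -/
theorem SimpleGraph.exists_isHamiltonianCycle_of_seq {V : Type*} [Fintype V] [DecidableEq V]
    (X : SimpleGraph V) (z : ℕ → V) (N : ℕ) (hN : 3 ≤ N) (hcard : Fintype.card V = N)
    (hadj : ∀ j, X.Adj (z j) (z (j + 1))) (hclosed : z N = z 0)
    (hinj : ∀ i < N, ∀ j < N, z i = z j → i = j) :
    ∃ (v : V) (w : X.Walk v v), w.IsHamiltonianCycle := by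
  obtain ⟨n, rfl⟩ : ∃ n, N = n + 3 := ⟨N - 3, by omega⟩
  have hstep : ∀ u v : Fin (n + 3), (v - u).val = 1 → X.Adj (z u) (z v) := by
    intro u v h
    have hv : v = u + 1 := by
      have : v - u = 1 := Fin.ext (by simpa using h)
      rw [← this]; abel
    subst hv
    rcases eq_or_ne u (Fin.last _) with rfl | hu
    · have := hadj (n + 2)
      rw [hclosed] at this
      simpa using this
    · rw [Fin.val_add_one_of_lt (Fin.lt_last_iff_ne_last.2 hu)]
      exact hadj _
  let f : SimpleGraph.cycleGraph (n + 3) →g X :=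
    ⟨fun i => z i, fun {u v} h => by
      rcases SimpleGraph.cycleGraph_adj'.1 h with h | h
      · exact (hstep _ _ h).symm
      · exact hstep _ _ h⟩
  have hf : Function.Injective f := fun i j h => Fin.ext (hinj _ i.2 _ j.2 h)
  refine ⟨_, (SimpleGraph.cycleGraph.cycle n).map f, ?_⟩
  rw [SimpleGraph.Walk.isHamiltonianCycle_iff_isCycle_and_length_eq]
  refine ⟨SimpleGraph.cycleGraph.isCycle_cycle.map hf, ?_⟩
  rw [SimpleGraph.Walk.length_map, SimpleGraph.cycleGraph.length_cycle, hcard]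

section Labels

variable {A : Type*} [CommGroup A]

/-- The sequence starting at `1` in which consecutive terms have the prescribed products `e j`. -/
def alternatingLabel (e : ℕ → A) : ℕ → A
  | 0 => 1
  | j + 1 => e j * (alternatingLabel e j)⁻¹

theorem alternatingLabel_add_period (e : ℕ → A) (n : ℕ) (he : ∀ j, e (j + n) = e j) (j : ℕ) :
    alternatingLabel e (j + n) =
      if Even j then alternatingLabel e n * alternatingLabel e j
      else (alternatingLabel e n)⁻¹ * alternatingLabel e j := by
  induction j with
  | zero => simp [alternatingLabel]
  | succ j ih =>
    rw [show j + 1 + n = (j + n) + 1 by ring, alternatingLabel, ih, he, alternatingLabel]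
    by_cases h : Even j
    · simp only [h, if_true, Nat.even_add_one, not_true, if_false, mul_inv]
      exact mul_left_comm _ _ _
    · simp only [h, if_false, Nat.even_add_one, not_false_iff, if_true, mul_inv, inv_inv]
      exact mul_left_comm _ _ _

theorem alternatingLabel_add_mul_period (e : ℕ → A) (n : ℕ) (hn : Even n)
    (he : ∀ j, e (j + n) = e j) (j q : ℕ) :
    alternatingLabel e (j + n * q) =
      if Even j then alternatingLabel e n ^ q * alternatingLabel e j
      else (alternatingLabel e n ^ q)⁻¹ * alternatingLabel e j := by
  induction q with
  | zero => simp
  | succ q ih =>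
    have hpar : Even (j + n * q) ↔ Even j := by simp [Nat.even_add, hn]
    rw [show j + n * (q + 1) = j + n * q + n by ring, alternatingLabel_add_period e n he, ih]
    by_cases h : Even j
    · simp only [hpar, h, if_true, pow_succ', mul_assoc]
    · simp only [hpar, h, if_false, pow_succ, mul_assoc, mul_inv]
      exact (mul_left_comm _ _ _)

/-- Labels of sequences that agree on an interval stay congruent, or stay incongruent, there. -/
theorem alternatingLabel_div_mem_iff (D : Subgroup A) (e e' : ℕ → A) (i m : ℕ)
    (h : ∀ j, i ≤ j → j < m → e j = e' j) (him : i ≤ m) :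
    alternatingLabel e m / alternatingLabel e' m ∈ D ↔
      alternatingLabel e i / alternatingLabel e' i ∈ D := by
  induction m, him using Nat.le_induction with
  | base => rfl
  | succ m him ih =>
    rw [← ih fun j hij hjm => h j hij (by omega), alternatingLabel, alternatingLabel,
      h m him (by omega), ← D.inv_mem_iff, mul_div_mul_left_eq_div, inv_div_inv, inv_div]

/-- If `x` has period `n` and its first `n` labels are read around a cycle with holonomy outside a
subgroup of prime index `r`, the pairs (point, label modulo `D`) repeat only after `n * r` steps. -/
theorem eq_of_alternatingLabel_div_mem {P : Type*} (D : Subgroup A) (r : ℕ) (hr : r.Prime)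
    (hD : D.index = r) (e : ℕ → A) (x : ℕ → P) (n : ℕ) (hn0 : 0 < n) (hn : Even n)
    (he : ∀ j, e (j + n) = e j) (hx : ∀ j, x (j + n) = x j)
    (hxinj : ∀ i < n, ∀ j < n, x i = x j → i = j) (hhol : alternatingLabel e n ∉ D)
    (i j : ℕ) (hi : i < n * r) (hj : j < n * r) (hij : x i = x j)
    (hl : alternatingLabel e i / alternatingLabel e j ∈ D) : i = j := by
  wlog hle : i ≤ j generalizing i j
  · exact (this j i hj hi hij.symm (by rw [← D.inv_mem_iff, inv_div]; exact hl) (by omega)).symm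
  have hmod : i % n = j % n := by
    refine hxinj _ (Nat.mod_lt _ hn0) _ (Nat.mod_lt _ hn0) ?_
    rw [Function.Periodic.map_mod_nat hx, Function.Periodic.map_mod_nat hx, hij]
  obtain ⟨q, hq⟩ := (Nat.modEq_iff_dvd' hle).1 hmod
  have hjq : j = i + n * q := by omega
  subst hjq
  have hpow : alternatingLabel e n ^ q ∈ D := by
    rw [alternatingLabel_add_mul_period e n hn he] at hl
    split_ifs at hl with h
    · rw [← D.inv_mem_iff]; simpa using hl
    · simpa using hl
  have hqr : q < r := by
    refine lt_of_mul_lt_mul_left (a := n) ?_ hn0.le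
    omega
  rcases Nat.eq_zero_or_pos q with rfl | hq0
  · simp
  · refine absurd ?_ hhol
    rw [← QuotientGroup.eq_one_iff, QuotientGroup.mk_pow] at hpow
    rw [← QuotientGroup.eq_one_iff]
    have hpr : ((alternatingLabel e n : A) : A ⧸ D) ^ r = 1 := by
      rw [← QuotientGroup.mk_pow, QuotientGroup.eq_one_iff, ← hD]
      exact D.pow_index_mem _
    have hcop : q.Coprime r := ((Nat.Prime.coprime_iff_not_dvd hr).2
      (Nat.not_dvd_of_pos_of_lt hq0 hqr)).symm
    have := pow_gcd_eq_one.2 ⟨hpow, hpr⟩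
    rwa [hcop.gcd_eq_one, pow_one] at this

end Labels

section SL2

variable {F : Type*} [Field F]

/-- The upper unitriangular matrices. -/
def upperHom : Multiplicative F →* SL(2, F) where
  toFun x := ⟨!![1, x.toAdd; 0, 1], by simp⟩
  map_one' := Subtype.ext (by simp [Matrix.one_fin_two])
  map_mul' x y := Subtype.ext (by
    change !![_, _; _, _] = !![(1 : F), x.toAdd; 0, 1] * !![1, y.toAdd; 0, 1]
    simp [add_comm])

/-- The diagonal matrices of determinant one. -/
def diagHom : Fˣ →* SL(2, F) where
  toFun a := ⟨!![(a : F), 0; 0, (a : F)⁻¹], by simp⟩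
  map_one' := Subtype.ext (by simp [Matrix.one_fin_two])
  map_mul' x y := Subtype.ext (by
    change !![_, _; _, _] = !![(x : F), 0; 0, (x : F)⁻¹] * !![(y : F), 0; 0, (y : F)⁻¹]
    simp [mul_comm])

/-- The matrices taking the point at infinity of the projective line to the finite points. -/
def affineRep (x : F) : SL(2, F) := ⟨!![x, -1; 1, 0], by simp⟩

/-- A matrix taking the point at infinity of the projective line to a given point. -/
def lineRep (P : Option F) : SL(2, F) := P.elim 1 affineRep

@[simp] theorem coe_upperHom (x : Multiplicative F) :
    (upperHom x : Matrix (Fin 2) (Fin 2) F) = !![1, x.toAdd; 0, 1] := rfl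

@[simp] theorem coe_diagHom (a : Fˣ) :
    (diagHom a : Matrix (Fin 2) (Fin 2) F) = !![(a : F), 0; 0, (a : F)⁻¹] := rfl

@[simp] theorem coe_affineRep (x : F) :
    (affineRep x : Matrix (Fin 2) (Fin 2) F) = !![x, -1; 1, 0] := rfl

theorem SL2.det_eq (g : SL(2, F)) : g 0 0 * g 1 1 - g 0 1 * g 1 0 = 1 := by
  rw [← Matrix.det_fin_two]; exact g.2

theorem SL2.mul_apply (g h : SL(2, F)) (i j : Fin 2) :
    (g * h) i j = g i 0 * h 0 j + g i 1 * h 1 j := by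
  rw [Matrix.SpecialLinearGroup.coe_mul, Matrix.mul_apply, Fin.sum_univ_two]

theorem SL2.inv_mul_apply_one_zero (g h : SL(2, F)) :
    (g⁻¹ * h) 1 0 = g 0 0 * h 1 0 - g 1 0 * h 0 0 := by
  simp [Matrix.mul_apply, Fin.sum_univ_two, Matrix.adjugate_fin_two]
  ring

theorem SL2.exists_upper_mul_mul_upper (g h : SL(2, F)) (hg : g 1 0 ≠ 0) (hgh : g 1 0 = h 1 0) :
    ∃ x y, h = upperHom x * g * upperHom y := by
  refine ⟨.ofAdd ((h 0 0 - g 0 0) / g 1 0), .ofAdd ((h 1 1 - g 1 1) / g 1 0), ?_⟩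
  have h1 := SL2.det_eq g
  have h2 := SL2.det_eq h
  rw [← hgh] at h2
  ext i j
  fin_cases i <;> fin_cases j <;>
    simp [SL2.mul_apply, -Matrix.SpecialLinearGroup.coe_mul, ← hgh]
  · field_simp; ring
  · field_simp
    linear_combination h1 - h2
  · field_simp; ring

theorem SL2.exists_diag_mul_upper (h : SL(2, F)) (h0 : h 1 0 = 0) :
    ∃ a x, h = diagHom a * upperHom x := by
  have h2 := SL2.det_eq h
  rw [h0, mul_zero, sub_zero] at h2
  have ha : h 0 0 ≠ 0 := left_ne_zero_of_mul_eq_one h2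
  refine ⟨Units.mk0 _ ha, .ofAdd (h 0 1 / h 0 0), ?_⟩
  ext i j
  fin_cases i <;> fin_cases j <;>
    simp [SL2.mul_apply, -Matrix.SpecialLinearGroup.coe_mul, h0]
  · field_simp
  · exact eq_inv_of_mul_eq_one_right h2

theorem SL2.natCard [Fintype F] :
    Nat.card SL(2, F) = Fintype.card F * (Fintype.card F - 1) * (Fintype.card F + 1) := by
  let f : (Fˣ × F) × Option F → SL(2, F) := fun y =>
    lineRep y.2 * (diagHom y.1.1 * upperHom (.ofAdd y.1.2))
  have hf : Function.Bijective f := by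
    constructor
    · rintro ⟨⟨a, x⟩, z⟩ ⟨⟨b, y⟩, z'⟩ h
      have h' := fun i j => congrArg (fun M : SL(2, F) => M i j) h
      have h00 := h' 0 0
      have h01 := h' 0 1
      have h10 := h' 1 0
      have h11 := h' 1 1
      rcases z with _ | z <;> rcases z' with _ | z' <;>
        simp [f, lineRep, SL2.mul_apply, -Matrix.SpecialLinearGroup.coe_mul] at h00 h01 h10 h11
      · obtain rfl := Units.ext h00; simpa using h01
      · exact absurd h10.symm b.ne_zero
      · obtain rfl := Units.ext h10
        simp_all
    · intro g
      by_cases h0 : g 1 0 = 0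
      · obtain ⟨a, x, rfl⟩ := SL2.exists_diag_mul_upper g h0
        exact ⟨((a, x.toAdd), none), by simp [f, lineRep]⟩
      · obtain ⟨a, x, h⟩ := SL2.exists_diag_mul_upper
          ((affineRep (g 0 0 / g 1 0))⁻¹ * g) (by
            rw [SL2.inv_mul_apply_one_zero]
            simp [h0])
        exact ⟨((a, x.toAdd), some (g 0 0 / g 1 0)), by simp [f, lineRep, ← h]⟩
  rw [← Nat.card_congr (Equiv.ofBijective f hf)]
  simp [Nat.card_prod, Nat.card_units]
  ring

theorem SL2.natCard_center [Fintype F] (h2 : (2 : F) ≠ 0) :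
    Nat.card (Subgroup.center SL(2, F)) = 2 := by
  rw [Nat.card_congr (Matrix.SpecialLinearGroup.center_equiv_rootsOfUnity (n := Fin 2)
    (R := F)).toEquiv]
  have : max (Fintype.card (Fin 2)) 1 = 2 := by simp
  rw [this]
  refine le_antisymm (card_rootsOfUnity F 2) ?_
  have hne : (-1 : Fˣ) ≠ 1 := fun h => h2 (by
    have := congrArg Units.val h
    simp only [Units.val_neg, Units.val_one] at this
    linear_combination -this)
  have : Nontrivial (rootsOfUnity 2 F) :=
    ⟨⟨⟨-1, by simp [mem_rootsOfUnity]⟩, 1, fun h => hne (congrArg Subtype.val h)⟩⟩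
  exact Finite.one_lt_card

theorem SL2.apply_one_zero_eq_zero_of_mem [Fintype F] (L : Subgroup SL(2, F))
    (hU : ∀ x, upperHom x ∈ L) (hL : Nat.card L < Fintype.card F ^ 2)
    (g : SL(2, F)) (hg : g ∈ L) : g 1 0 = 0 := by
  by_contra h0
  refine absurd hL (not_lt.2 ?_)
  let f : F × F → L := fun y => ⟨upperHom (.ofAdd y.1) * g * upperHom (.ofAdd y.2),
    L.mul_mem (L.mul_mem (hU _) hg) (hU _)⟩
  have hf : Function.Injective f := by
    rintro ⟨x, y⟩ ⟨x', y'⟩ h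
    have h' := fun i j => congrArg (fun M : L => (M : SL(2, F)) i j) h
    have h00 := h' 0 0
    have h11 := h' 1 1
    simp [f, SL2.mul_apply, -Matrix.SpecialLinearGroup.coe_mul, h0] at h00 h11
    simp [h00, h11]
  simpa [Nat.card_prod, sq] using Nat.card_le_card_of_injective f hf

theorem SL2.natCard_eq_of_triangular [Fintype F] (L : Subgroup SL(2, F))
    (hU : ∀ x, upperHom x ∈ L) (hL : ∀ g ∈ L, g 1 0 = 0) :
    Nat.card L = Nat.card (L.comap diagHom) * Fintype.card F := by
  let f : L.comap diagHom × F → L := fun y => ⟨diagHom y.1 * upperHom (.ofAdd y.2),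
    L.mul_mem y.1.2 (hU _)⟩
  have hf : Function.Bijective f := by
    constructor
    · rintro ⟨a, x⟩ ⟨b, y⟩ h
      have h' := fun i j => congrArg (fun M : L => (M : SL(2, F)) i j) h
      have h00 := h' 0 0
      have h01 := h' 0 1
      simp [f, SL2.mul_apply, -Matrix.SpecialLinearGroup.coe_mul] at h00 h01
      obtain rfl := Subtype.ext (Units.ext h00)
      simpa using h01
    · rintro ⟨g, hg⟩
      obtain ⟨a, x, rfl⟩ := SL2.exists_diag_mul_upper g (hL g hg)
      exact ⟨(⟨a, (L.mul_mem_cancel_right (hU x)).1 hg⟩, x.toAdd), rfl⟩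
  rw [← Nat.card_congr (Equiv.ofBijective f hf), Nat.card_prod, Nat.card_eq_fintype_card (α := F)]


/-- The determinant of the first columns of the representatives of two points. -/
def pointDet (P Q : Option F) : F :=
  lineRep P 0 0 * lineRep Q 1 0 - lineRep P 1 0 * lineRep Q 0 0

@[simp] theorem pointDet_none_some (x : F) : pointDet none (some x) = 1 := by
  simp [pointDet, lineRep]

@[simp] theorem pointDet_some_none (x : F) : pointDet (some x) none = -1 := by
  simp [pointDet, lineRep]

@[simp] theorem pointDet_some_some (x y : F) : pointDet (some x) (some y) = x - y := by
  simp [pointDet, lineRep]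

theorem pointDet_ne_zero {P Q : Option F} (h : P ≠ Q) : pointDet P Q ≠ 0 := by
  rcases P with _ | x <;> rcases Q with _ | y
  · exact absurd rfl h
  · simp
  · simp
  · simpa [sub_eq_zero] using h

open Classical in
/-- The product of the labels required at two consecutive points in order that the
bottom left entry of the connecting matrix be `t`. -/
noncomputable def linkLabel (t : Fˣ) (P Q : Option F) : Fˣ :=
  if h : P = Q then 1 else t / Units.mk0 (pointDet P Q) (pointDet_ne_zero h)

theorem linkLabel_mul_pointDet (t : Fˣ) {P Q : Option F} (h : P ≠ Q) :
    (linkLabel t P Q : F) * pointDet P Q = t := by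
  simp [linkLabel, h, pointDet_ne_zero h]

theorem List.Nodup.exists_periodic_getD {α : Type*} [Fintype α] {l : List α} (hl : l.Nodup)
    (hmem : ∀ a, a ∈ l) (d : α) :
    (∀ j, l.getD ((j + Fintype.card α) % Fintype.card α) d = l.getD (j % Fintype.card α) d) ∧
      ∀ i < Fintype.card α, ∀ j < Fintype.card α,
        l.getD (i % Fintype.card α) d = l.getD (j % Fintype.card α) d → i = j := by
  classical
  have hlen : l.length = Fintype.card α := by
    rw [← List.toFinset_card_of_nodup hl, ← Finset.card_univ]
    congr 1
    ext a
    simp [hmem]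
  refine ⟨fun j => by rw [Nat.add_mod_right], fun i hi j hj h => ?_⟩
  rw [Nat.mod_eq_of_lt hi, Nat.mod_eq_of_lt hj, List.getD_eq_getElem _ _ (hlen ▸ hi),
    List.getD_eq_getElem _ _ (hlen ▸ hj)] at h
  exact (hl.getElem_inj_iff).1 h

/-- The points of the projective line over a finite field can be enumerated cyclically with
holonomy outside any given proper subgroup of odd index. -/
theorem exists_enumeration_alternatingLabel_notMem [Fintype F] (D : Subgroup Fˣ)
    (hodd : Odd D.index) (hD : D ≠ ⊤) (t : Fˣ) :
    ∃ x : ℕ → Option F, (∀ j, x (j + (Fintype.card F + 1)) = x j) ∧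
      (∀ i < Fintype.card F + 1, ∀ j < Fintype.card F + 1, x i = x j → i = j) ∧
      alternatingLabel (fun j => linkLabel t (x j) (x (j + 1))) (Fintype.card F + 1) ∉ D := by
  classical
  obtain ⟨b, hb⟩ : ∃ b, b ∉ D := by
    by_contra! h
    exact hD (eq_top_iff.2 fun b _ => h b)
  have hb1 : (b : F) ≠ 1 := fun h => hb (by
    rw [Units.ext (h.trans Units.val_one.symm)]
    exact D.one_mem)
  have hneg : (-1 : Fˣ) ∈ D := by
    rw [← hodd.neg_one_pow]
    exact D.pow_index_mem _
  have hcard : Fintype.card (Option F) = Fintype.card F + 1 := Fintype.card_option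
  let R : List (Option F) :=
    (Finset.univ \ {none, some (b : F), some 1, some 0} : Finset (Option F)).toList
  let l : F → F → List (Option F) := fun c d => none :: some c :: some d :: some 0 :: R
  have hl : (l b 1).Nodup := by
    simp [l, R, Finset.nodup_toList, hb1]
  have hl' : (l 1 b).Nodup := by
    simp [l, R, Finset.nodup_toList, hb1.symm]
  have hm : ∀ a, a ∈ l b 1 := by simp [l, R]; tauto
  have hm' : ∀ a, a ∈ l 1 b := by simp [l, R]; tauto
  have h4 : 4 ≤ Fintype.card F + 1 := by
    rw [← hcard, ← Finset.card_univ]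
    calc 4 = ({none, some (b : F), some 1, some 0} : Finset (Option F)).card := by
          simp [hb1]
      _ ≤ _ := Finset.card_le_card (Finset.subset_univ _)
  let x : F → F → ℕ → Option F := fun c d j => (l c d).getD (j % (Fintype.card F + 1)) none
  let e : F → F → ℕ → Fˣ := fun c d j => linkLabel t (x c d j) (x c d (j + 1))
  have hx (c d : F) (j : ℕ) (hj : j < 4) :
      x c d j = (l c d).getD j none := by
    simp only [x]; rw [Nat.mod_eq_of_lt (by omega)]
  have hagree (c d c' d' : F) (j : ℕ) (h3 : 3 ≤ j) (hj : j ≤ Fintype.card F + 1) :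
      x c d j = x c' d' j := by
    simp only [x]
    rcases hj.eq_or_lt with rfl | hj
    · simp [l]
    · rw [Nat.mod_eq_of_lt hj]
      obtain ⟨i, rfl⟩ := Nat.exists_eq_add_of_le' h3
      simp [l]
  have hiff := alternatingLabel_div_mem_iff D (e b 1) (e 1 b) 3 (Fintype.card F + 1)
    (fun j h3 hj => by
      simp only [e]
      rw [hagree b 1 1 b j h3 hj.le, hagree b 1 1 b (j + 1) (by omega) hj]) (by omega)
  have h3 : alternatingLabel (e b 1) 3 / alternatingLabel (e 1 b) 3 = -1 * b := by
    have hb0 := b.ne_zero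
    have h1 := sub_ne_zero.2 hb1
    have h2 := sub_ne_zero.2 hb1.symm
    ext
    simp [alternatingLabel, e, hx, l, linkLabel, hb1, hb1.symm]
    field_simp
    ring
  have hnot : alternatingLabel (e b 1) (Fintype.card F + 1) /
      alternatingLabel (e 1 b) (Fintype.card F + 1) ∉ D := by
    rw [hiff, h3, D.mul_mem_cancel_left hneg]
    exact hb
  have key (c d : F) (hn : (l c d).Nodup) (hmem : ∀ a, a ∈ l c d)
      (h : alternatingLabel (e c d) (Fintype.card F + 1) ∉ D) := by
    have := hn.exists_periodic_getD hmem none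
    rw [hcard] at this
    exact (⟨x c d, this.1, this.2, h⟩ :
      ∃ x : ℕ → Option F, (∀ j, x (j + (Fintype.card F + 1)) = x j) ∧
      (∀ i < Fintype.card F + 1, ∀ j < Fintype.card F + 1, x i = x j → i = j) ∧
      alternatingLabel (fun j => linkLabel t (x j) (x (j + 1))) (Fintype.card F + 1) ∉ D)
  by_cases h : alternatingLabel (e b 1) (Fintype.card F + 1) ∈ D
  · exact key 1 b hl' hm' fun h' => hnot (D.div_mem h h')
  · exact key b 1 hl hm h

end SL2

section Action

variable {V : Type*} {F : Type*} [Field F] [MulAction SL(2, F) V]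

theorem SL2.exists_upperHom_smul_eq [Fintype F] [Finite V]
    (h : (Nat.card V).Coprime (Fintype.card F)) : ∃ v : V, ∀ x : Multiplicative F,
      (upperHom x : SL(2, F)) • v = v := by
  obtain ⟨q, hq⟩ := CharP.exists F
  obtain ⟨m, hqp, hm⟩ := FiniteField.card F q
  have : Fact q.Prime := ⟨hqp⟩
  let _ : MulAction (Multiplicative F) V := MulAction.compHom V (upperHom (F := F))
  have hP : IsPGroup q (Multiplicative F) := IsPGroup.of_card (n := m) (by
    rw [← hm, ← Nat.card_eq_fintype_card]; rfl)
  obtain ⟨v, hv⟩ := hP.nonempty_fixed_point_of_prime_not_dvd_card V fun hdvd =>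
    hqp.one_lt.ne' (Nat.dvd_one.1 (h ▸ Nat.dvd_gcd hdvd (hm ▸ dvd_pow_self q m.ne_zero)))
  exact ⟨v, hv⟩

/-- A connected graph with a vertex-transitive action of `SL(2, F)` in which the stabilizer of `v`
is triangular has an edge at `v` that leaves the triangular subgroup. -/
theorem SL2.exists_adj_smul [MulAction.IsPretransitive SL(2, F) V] (X : SimpleGraph V)
    (hconn : X.Connected) (hadj : ∀ (g : SL(2, F)) u v, X.Adj u v → X.Adj (g • u) (g • v)) (v : V)
    (hL : ∀ g ∈ MulAction.stabilizer SL(2, F) v, g 1 0 = 0) :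
    ∃ g : SL(2, F), g 1 0 ≠ 0 ∧ X.Adj v (g • v) := by
  by_contra! h
  have hall : ∀ u, Relation.ReflTransGen X.Adj v u → ∃ b : SL(2, F), b 1 0 = 0 ∧ b • v = u := by
    intro u hu
    induction hu with
    | refl => exact ⟨1, by simp, one_smul _ _⟩
    | @tail _ c _ hab ih =>
      obtain ⟨b, hb, rfl⟩ := ih
      obtain ⟨g, rfl⟩ := MulAction.exists_smul_eq SL(2, F) v c
      have hbg : (b⁻¹ * g) 1 0 = 0 := by
        by_contra h0
        refine h _ h0 ?_
        simpa [mul_smul] using hadj b⁻¹ _ _ hab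
      have hdet := SL2.det_eq b
      rw [SL2.inv_mul_apply_one_zero, hb, zero_mul, sub_zero] at hbg
      rw [hb, mul_zero, sub_zero] at hdet
      exact ⟨g, (mul_eq_zero.1 hbg).resolve_left (left_ne_zero_of_mul_eq_one hdet), rfl⟩
  obtain ⟨b, hb, hbv⟩ := hall ((affineRep 0 : SL(2, F)) • v)
    (SimpleGraph.reachable_iff_reflTransGen _ _ |>.1 (hconn.preconnected _ _))
  have hmem : b⁻¹ * affineRep (0 : F) ∈ MulAction.stabilizer SL(2, F) v := by
    rw [MulAction.mem_stabilizer_iff, mul_smul, ← hbv, inv_smul_smul]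
  have h0 := hL _ hmem
  have hdet := SL2.det_eq b
  rw [SL2.inv_mul_apply_one_zero] at h0
  simp [hb] at h0 hdet
  simp [h0] at hdet

end Action

theorem SL2.exists_isHamiltonianCycle {V : Type*} [Fintype V] [DecidableEq V] {F : Type*} [Field F]
    [Fintype F] [MulAction SL(2, F) V] [MulAction.IsPretransitive SL(2, F) V] (X : SimpleGraph V)
    (hconn : X.Connected) (hadj : ∀ (g : SL(2, F)) u v, X.Adj u v → X.Adj (g • u) (g • v))
    (hcard : Fintype.card V = 5 * (Fintype.card F + 1)) (hodd : Odd (Fintype.card F))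
    (h5 : ¬ 5 ∣ Fintype.card F) : ∃ (v : V) (w : X.Walk v v), w.IsHamiltonianCycle := by
  have hF1 : 1 < Fintype.card F := Fintype.one_lt_card
  obtain ⟨v, hv⟩ := SL2.exists_upperHom_smul_eq (V := V) (F := F) (by
    rw [Nat.card_eq_fintype_card, hcard]
    refine Nat.Coprime.mul_left ((Nat.Prime.coprime_iff_not_dvd Nat.prime_five).2 h5) ?_
    simp)
  set L := MulAction.stabilizer SL(2, F) v with hLdef
  have hLcard : 5 * Nat.card L = Fintype.card F * (Fintype.card F - 1) := by
    have h1 := L.card_mul_index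
    rw [MulAction.index_stabilizer_of_transitive, Nat.card_eq_fintype_card (α := V), hcard,
      SL2.natCard] at h1
    refine Nat.eq_of_mul_eq_mul_right (Nat.succ_pos (Fintype.card F)) ?_
    rw [← h1, Nat.succ_eq_add_one]
    ring
  have hU : ∀ x, upperHom x ∈ L := hv
  have hL : ∀ g ∈ L, g 1 0 = 0 := SL2.apply_one_zero_eq_zero_of_mem L hU (by
    have : Fintype.card F * (Fintype.card F - 1) ≤ Fintype.card F ^ 2 := by
      rw [sq]; exact Nat.mul_le_mul_left _ (Nat.sub_le _ _)
    have : 0 < Fintype.card F ^ 2 := by positivity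
    omega)
  set D := L.comap diagHom with hDdef
  have hDindex : D.index = 5 := by
    have h1 := D.card_mul_index
    have h2 := SL2.natCard_eq_of_triangular L hU hL
    rw [← hDdef] at h2
    rw [Nat.card_units, Nat.card_eq_fintype_card (α := F)] at h1
    have hDpos : 0 < Nat.card D := Nat.card_pos
    refine Nat.eq_of_mul_eq_mul_left (Nat.mul_pos hDpos (Fintype.card_pos (α := F))) ?_
    calc _ = (Nat.card D * D.index) * Fintype.card F := by ring
      _ = 5 * Nat.card L := by rw [h1, hLcard, mul_comm]
      _ = _ := by rw [h2, mul_comm]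
  obtain ⟨g, hg0, hg⟩ := SL2.exists_adj_smul X hconn hadj v hL
  have hstep (M N : SL(2, F)) (h : M 0 0 * N 1 0 - M 1 0 * N 0 0 = g 1 0) :
      X.Adj (M • v) (N • v) := by
    rw [← SL2.inv_mul_apply_one_zero] at h
    obtain ⟨x, y, hxy⟩ := SL2.exists_upper_mul_mul_upper g (M⁻¹ * N) hg0 h.symm
    have hN : N = M * upperHom x * g * upperHom y := by
      rw [mul_assoc, mul_assoc, ← mul_assoc _ g, ← hxy, mul_inv_cancel_left]
    simpa [hN, mul_smul, hv] using hadj (M * upperHom x) _ _ hg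
  obtain ⟨x, hxper, hxinj, hhol⟩ := exists_enumeration_alternatingLabel_notMem D
    (by rw [hDindex]; decide) (fun h => by simp [h] at hDindex) (Units.mk0 _ hg0)
  set n := Fintype.card F + 1 with hn
  set e : ℕ → Fˣ := fun j => linkLabel (Units.mk0 _ hg0) (x j) (x (j + 1)) with he
  have heper (j : ℕ) : e (j + n) = e j := by
    simp only [he]
    rw [hxper, add_right_comm, hxper]
  have hxne (j : ℕ) : x j ≠ x (j + 1) := fun h => by
    rw [← Function.Periodic.map_mod_nat hxper j,
      ← Function.Periodic.map_mod_nat hxper (j + 1)] at h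
    have hmod : j ≡ j + 1 [MOD n] := hxinj _ (Nat.mod_lt _ (by omega)) _ (Nat.mod_lt _ (by omega)) h
    have := Nat.le_of_dvd one_pos (by simpa using (Nat.modEq_iff_dvd' (Nat.le_succ j)).1 hmod)
    omega
  have hzeq (P Q : Option F) (a b : Fˣ)
      (h : (lineRep P * diagHom a) • v = (lineRep Q * diagHom b) • v) : P = Q ∧ a / b ∈ D := by
    have hmem : (lineRep P * diagHom a)⁻¹ * (lineRep Q * diagHom b) ∈ L := by
      rw [hLdef, MulAction.mem_stabilizer_iff, mul_smul, ← h, inv_smul_smul]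
    have hPQ : P = Q := by
      by_contra hne
      have h0 := hL _ hmem
      rw [SL2.inv_mul_apply_one_zero] at h0
      refine mul_ne_zero (mul_ne_zero a.ne_zero b.ne_zero) (pointDet_ne_zero hne) ?_
      rw [← h0]
      simp [SL2.mul_apply, -Matrix.SpecialLinearGroup.coe_mul, pointDet]
      ring
    subst hPQ
    refine ⟨rfl, ?_⟩
    rw [← D.inv_mem_iff, inv_div, div_eq_inv_mul, hDdef, Subgroup.mem_comap, map_mul, map_inv]
    simpa [mul_assoc] using hmem
  refine X.exists_isHamiltonianCycle_of_seq
    (fun j => (lineRep (x j) * diagHom (alternatingLabel e j)) • v) (n * 5) (by omega)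
    (by rw [hcard, mul_comm]) ?_ ?_ ?_
  · intro j
    refine hstep _ _ ?_
    have := linkLabel_mul_pointDet (Units.mk0 _ hg0) (hxne j)
    rw [Units.val_mk0] at this
    rw [← this]
    simp [SL2.mul_apply, -Matrix.SpecialLinearGroup.coe_mul, pointDet, alternatingLabel, he]
    field_simp
  · have hx5 : x (n * 5) = x 0 := by
      have := Function.Periodic.nat_mul hxper 5 0
      simpa [mul_comm] using this
    have hl := alternatingLabel_add_mul_period e n hodd.add_one heper 0 5
    simp only [zero_add, Even.zero, if_true] at hl
    have hmem : diagHom (alternatingLabel e n ^ 5) ∈ L := by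
      rw [← hDindex]; exact D.pow_index_mem _
    simp only [hx5, hl, alternatingLabel, mul_one, map_one, mul_smul]
    rw [MulAction.mem_stabilizer_iff.1 hmem]
  · intro i hi j hj hij
    obtain ⟨hP, ha⟩ := hzeq _ _ _ _ hij
    exact eq_of_alternatingLabel_div_mem D 5 Nat.prime_five hDindex e x n (Nat.succ_pos _)
      hodd.add_one heper hxper hxinj hhol i j hi hj hP ha

/-- Let `s` be a prime, `k = s^m` a prime power with `k + 1 = 2p` for a prime `p`, and suppose
`10 ∣ k - 1`. Let `X` be a connected simple graph whose automorphism group contains a subgroup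
`G ≅ PSL(2, k)` acting transitively on the vertices, such that the stabilizer in `G` of a vertex
is isomorphic to `(ℤ_s)^m ⋊ ℤ_{(k-1)/10}`. Then `X` contains a Hamilton cycle. -/
theorem stmt0 {V : Type*} [Fintype V] [DecidableEq V]
    (s m p k : ℕ) (hs : s.Prime) (hm : 0 < m) (hk : k = s ^ m)
    (hp : p.Prime) (h2p : k + 1 = 2 * p) (hdvd : 10 ∣ k - 1)
    (F : Type*) [Field F] [Fintype F] (hF : Fintype.card F = k)
    (X : SimpleGraph V) (hconn : X.Connected)
    (G : Subgroup (X ≃g X))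
    (hiso : Nonempty (G ≃* PSL(2, F)))
    (htrans : ∀ u v : V, ∃ g ∈ G, g.toEquiv u = v)
    (hstab : ∀ v : V,
      ∃ φ : Multiplicative (ZMod ((k - 1) / 10)) →* MulAut (Multiplicative (Fin m → ZMod s)),
      Nonempty
        ((↥(G ⊓ Subgroup.comap (autToPerm X) (MulAction.stabilizer (Equiv.Perm V) v))) ≃*
          SemidirectProduct (Multiplicative (Fin m → ZMod s))
            (Multiplicative (ZMod ((k - 1) / 10))) φ)) :
    ∃ (v : V) (w : X.Walk v v), w.IsHamiltonianCycle := by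
  obtain ⟨iso⟩ := hiso
  subst hF
  have hF1 : 1 < Fintype.card F := Fintype.one_lt_card
  obtain ⟨c, hc⟩ := hdvd
  have hodd : Odd (Fintype.card F) := ⟨p - 1, by have := hp.pos; omega⟩
  have h2 : (2 : F) ≠ 0 := fun h2 => by
    obtain ⟨j, hj⟩ := hodd
    have h := FiniteField.cast_card_eq_zero F
    rw [hj] at h
    simp [h2] at h
  obtain ⟨v⟩ := hconn.nonempty
  let H := (MulAction.stabilizer (Equiv.Perm V) v).comap (autToPerm X)
  have hH : Nat.card ↥(G ⊓ H) = Fintype.card F * c := by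
    obtain ⟨φ, ⟨ψ⟩⟩ := hstab v
    have : NeZero s := ⟨hs.ne_zero⟩
    rw [Nat.card_congr ψ.toEquiv, SemidirectProduct.card, hc, Nat.mul_div_cancel_left _ (by omega),
      hk]
    congr 1
    · simp
    · simp [Nat.card_congr Multiplicative.toAdd]
  let _ : MulAction G V := MulAction.compHom V ((autToPerm X).comp G.subtype)
  have : MulAction.IsPretransitive G V := ⟨fun u w =>
    let ⟨g, hg, h⟩ := htrans u w
    ⟨⟨g, hg⟩, h⟩⟩
  have hstabG : Nat.card (MulAction.stabilizer G v) = Fintype.card F * c := by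
    rw [← hH, ← Nat.card_congr (Subgroup.subgroupOfEquivOfLe (inf_le_left : G ⊓ H ≤ G)).toEquiv,
      Subgroup.inf_subgroupOf_left]
    rfl
  have hG : Nat.card G * 2 =
      Fintype.card F * (Fintype.card F - 1) * (Fintype.card F + 1) := by
    rw [← SL2.natCard, Subgroup.card_eq_card_quotient_mul_card_subgroup
      (Subgroup.center SL(2, F)), SL2.natCard_center h2, Nat.card_congr iso.toEquiv]
  have hV : Fintype.card V = 5 * (Fintype.card F + 1) := by
    have h := (MulAction.stabilizer G v).card_mul_index
    rw [MulAction.index_stabilizer_of_transitive, hstabG, Nat.card_eq_fintype_card] at h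
    rw [← h, hc] at hG
    have hpos : 0 < 2 * (Fintype.card F * c) :=
      Nat.mul_pos two_pos (Nat.mul_pos (by omega) (by omega))
    refine Nat.eq_of_mul_eq_mul_left hpos ?_
    linarith
  let π : SL(2, F) →* G := iso.symm.toMonoidHom.comp (QuotientGroup.mk' (Subgroup.center SL(2, F)))
  have hπ : Function.Surjective π :=
    iso.symm.surjective.comp (QuotientGroup.mk'_surjective _)
  let _ : MulAction SL(2, F) V := MulAction.compHom V π
  have : MulAction.IsPretransitive SL(2, F) V := ⟨fun u w => by
    obtain ⟨g, hg⟩ := MulAction.exists_smul_eq G u w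
    obtain ⟨M, rfl⟩ := hπ g
    exact ⟨M, hg⟩⟩
  exact SL2.exists_isHamiltonianCycle (F := F) X hconn
    (fun g u w h => (π g).1.map_adj_iff.2 h) hV hodd (by omega)
end

section
/- With the setup below, for each i ∈ {0, 1, 2, 3, 4} the orbital O_i = {(α^g, α^{t^i ℓ h g}) : g ∈ G, h ∈ H} of G acting on Ω × Ω is self-paired, i.e., (x, y) ∈ O_i implies (y, x) ∈ O_i. -/
open Matrix
open scoped MatrixGroups

namespace Paper

variable {F : Type*} [Field F]

/-- The natural projection `SL(2, F) → PSL(2, F)`. -/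
def pr (F : Type*) [Field F] : SL(2, F) →* PSL(2, F) := QuotientGroup.mk' _

/-- The image of the matrix `[[0, -1], [1, 0]]` in `SL(2, F)`. -/
def lmat (F : Type*) [Field F] : SL(2, F) :=
  ⟨!![0, -1; 1, 0], by norm_num [Matrix.det_fin_two_of]⟩

/-- The image of the diagonal matrix `diag (θ, θ⁻¹)` in `SL(2, F)`. -/
def tmat (θ : Fˣ) : SL(2, F) :=
  ⟨!![(θ : F), 0; 0, ((θ⁻¹ : Fˣ) : F)], by
    simp [Matrix.det_fin_two_of, ← Units.val_mul]⟩

/-- The image of the matrix `[[1, 1], [0, 1]]` in `SL(2, F)`. -/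
def umat (F : Type*) [Field F] : SL(2, F) :=
  ⟨!![1, 1; 0, 1], by norm_num [Matrix.det_fin_two_of]⟩

/-- The element `s(a, b)`, i.e. the image of `[[a, b], [bθ, a]]`, in `SL(2, F)`,
where `a ^ 2 - b ^ 2 * θ = 1`. -/
def smat (θ a b : F) (h : a ^ 2 - b ^ 2 * θ = 1) : SL(2, F) :=
  ⟨!![a, b; b * θ, a], by rw [Matrix.det_fin_two_of]; linear_combination h⟩

/-- The set `S = {s(a, b) | a ^ 2 - b ^ 2 θ = 1}` inside `PSL(2, F)`. -/
def Sset (θ : Fˣ) : Set (PSL(2, F)) :=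
  {x | ∃ (a b : F) (h : a ^ 2 - b ^ 2 * (θ : F) = 1), x = pr F (smat (θ : F) a b h)}

/-- The subgroup `K = ⟨u, t⟩` of `PSL(2, F)`. -/
def Ksub (θ : Fˣ) : Subgroup (PSL(2, F)) :=
  Subgroup.closure {pr F (umat F), pr F (tmat θ)}

/-- The subgroup `H = ⟨u, t^5⟩` of `PSL(2, F)`. -/
def Hsub (θ : Fˣ) : Subgroup (PSL(2, F)) :=
  Subgroup.closure {pr F (umat F), (pr F (tmat θ)) ^ 5}

/-- `Ω = G/H`, the set of right cosets `Hg` of `H` in `G = PSL(2, F)`. -/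
def Omega (θ : Fˣ) : Type _ := Quotient (QuotientGroup.rightRel (Hsub θ))

/-- `α^g = Hg`, the right coset of `g`. -/
def av (θ : Fˣ) (g : PSL(2, F)) : Omega θ :=
  Quotient.mk (QuotientGroup.rightRel (Hsub θ)) g

/-- The action of `G = PSL(2, F)` on `Ω` by right multiplication. -/
def rmul (θ : Fˣ) (x : Omega θ) (g : PSL(2, F)) : Omega θ :=
  Quotient.map' (· * g)
    (fun a b hab => by
      have h := QuotientGroup.rightRel_apply.mp hab
      refine QuotientGroup.rightRel_apply.mpr ?_
      have hh : b * g * (a * g)⁻¹ = b * a⁻¹ := by group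
      rw [hh]; exact h) x

/-- The orbital `O_i = {(α^g, α^{t^i ℓ h g}) : g ∈ G, h ∈ H}`. -/
def Orb (θ : Fˣ) (i : ℕ) : Set (Omega θ × Omega θ) :=
  {q | ∃ (g h : PSL(2, F)), h ∈ Hsub θ ∧
    q = (av θ g, av θ ((pr F (tmat θ)) ^ i * pr F (lmat F) * h * g))}

/-- The basic orbital graph `Y(i) = X(G, O_i)`. -/
def Y (θ : Fˣ) (i : ℕ) : SimpleGraph (Omega θ) :=
  SimpleGraph.fromRel (fun x y => (x, y) ∈ Orb θ i)

/-- The orbit of a point of `Ω` under the right multiplication action of a subset of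
`PSL(2, F)`. -/
def orbOf (θ : Fˣ) (M : Set (PSL(2, F))) (x : Omega θ) : Set (Omega θ) :=
  {y | ∃ g ∈ M, y = rmul θ x g}


theorem semiconjBy_lmat_tmat (θ : Fˣ) : SemiconjBy (lmat F) (tmat θ) (tmat θ)⁻¹ := by
  refine Subtype.ext ?_
  rw [Matrix.SpecialLinearGroup.coe_mul, Matrix.SpecialLinearGroup.coe_mul,
    Matrix.SpecialLinearGroup.coe_inv]
  simp [lmat, tmat, Matrix.adjugate_fin_two]

theorem pr_lmat_mul_self : pr F (lmat F) * pr F (lmat F) = 1 := by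
  rw [← map_mul]
  refine (QuotientGroup.eq_one_iff _).mpr ?_
  have h : lmat F * lmat F = -1 := by
    refine Subtype.ext ?_
    rw [Matrix.SpecialLinearGroup.coe_mul, Matrix.SpecialLinearGroup.coe_neg]
    ext i j
    fin_cases i <;> fin_cases j <;> simp [lmat]
  rw [h, Subgroup.mem_center_iff]
  simp

/-- The representative `tⁱ ℓ` of the orbital `O_i` is an involution. -/
theorem tmat_pow_mul_lmat_mul_self (θ : Fˣ) (i : ℕ) :
    (pr F (tmat θ) ^ i * pr F (lmat F)) * (pr F (tmat θ) ^ i * pr F (lmat F)) = 1 := by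
  have h : SemiconjBy (pr F (lmat F)) (pr F (tmat θ) ^ i) (pr F (tmat θ) ^ i)⁻¹ := by
    simpa using ((semiconjBy_lmat_tmat θ).map (pr F)).pow_right i
  rw [mul_assoc, ← mul_assoc (pr F (lmat F)), h.eq, mul_assoc, pr_lmat_mul_self]
  simp

theorem av_mul_left_of_mem (θ : Fˣ) {h : PSL(2, F)} (hh : h ∈ Hsub θ) (g : PSL(2, F)) :
    av θ (h * g) = av θ g := by
  refine Quotient.sound (QuotientGroup.rightRel_apply.mpr ?_)
  simpa using hh

/-- For each `i ∈ {0,…,4}`, the orbital `O_i = {(α^g, α^{tⁱ ℓ h g}) : g ∈ G, h ∈ H}` of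
`G = PSL(2, k)` acting on `Ω × Ω` is self-paired: `(x, y) ∈ O_i` implies `(y, x) ∈ O_i`. -/
theorem stmt4 [Fintype F] (s m p k : ℕ) (hs : s.Prime) (hm : 0 < m) (hk : k = s ^ m)
    (hcard : Fintype.card F = k) (hdvd : 10 ∣ k - 1) (hp : p.Prime) (h2p : k + 1 = 2 * p)
    (θ : Fˣ) (hθ : ∀ x : Fˣ, x ∈ Subgroup.zpowers θ) :
    ∀ i : Fin 5, ∀ x y : Omega θ, (x, y) ∈ Orb θ (i : ℕ) → (y, x) ∈ Orb θ (i : ℕ) := by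
  rintro i x y ⟨g, h, hh, hq⟩
  obtain ⟨rfl, rfl⟩ := Prod.mk.inj hq
  refine ⟨_, 1, one_mem _, Prod.ext rfl ?_⟩
  simp only [mul_one]
  rw [mul_assoc _ h g, ← mul_assoc, tmat_pow_mul_lmat_mul_self, one_mul, av_mul_left_of_mem θ hh]

end Paper
end

section
/- Let F_q be a finite field of order q, let a_1, a_2, b ∈ F_q^*, and let k_1, k_2 be positive integers. Let N be the number of solutions (x_1, x_2) ∈ F_q × F_q of the diagonal equation a_1 x_1^{k_1} + a_2 x_2^{k_2} = b. Then |N − q| ≤ [(d_1 − 1)(d_2 − 1) − (1 − q^{−1/2}) M(d_1, d_2)] q^{1/2}, where d_i = gcd(k_i, q − 1) for i = 1, 2, and M(d_1, d_2) is the number of pairs (j_1, j_2) of integers with 1 ≤ j_i ≤ d_i − 1 for i = 1, 2 and j_1/d_1 + j_2/d_2 ∈ Z. -/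
open Finset

section CharacterSums

variable {F : Type*} [Field F] [Fintype F]

theorem norm_mulChar_le_one (χ : MulChar F ℂ) (a : F) : ‖χ a‖ ≤ 1 := by
  by_cases ha : a = 0
  · simp [ha, MulChar.map_zero]
  · obtain ⟨ζ, hζ, h⟩ := χ.apply_mem_rootsOfUnity_orderOf ha
    have : NeZero (orderOf χ) := ⟨χ.orderOf_pos.ne'⟩
    rw [← h, Complex.norm_eq_one_of_mem_rootsOfUnity hζ]

theorem norm_jacobiSum_inv_le_one {χ φ : MulChar F ℂ} (hχ : χ ≠ 1) (h : χ * φ = 1) :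
    ‖jacobiSum χ φ‖ ≤ 1 := by
  classical
  obtain rfl : φ = χ⁻¹ := eq_inv_of_mul_eq_one_right h
  rw [jacobiSum_nontrivial_inv hχ, norm_neg]
  exact norm_mulChar_le_one χ _

theorem norm_jacobiSum {χ φ : MulChar F ℂ} (hχ : χ ≠ 1) (hφ : φ ≠ 1) (h : χ * φ ≠ 1) :
    ‖jacobiSum χ φ‖ = √(Fintype.card F) := by
  have hchar : ringChar ℂ ≠ ringChar F := by
    rw [ringChar.eq_zero]
    exact (CharP.ringChar_ne_zero_of_finite F).symm
  have hJ := jacobiSum_mul_jacobiSum_inv hchar hχ hφ h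
  have hconj : jacobiSum χ⁻¹ φ⁻¹ = (starRingEnd ℂ) (jacobiSum χ φ) := by
    simp only [jacobiSum, map_sum, map_mul, ← MulChar.star_apply', RCLike.star_def]
  rw [hconj, Complex.mul_conj'] at hJ
  rw [eq_comm, Real.sqrt_eq_iff_mul_self_eq (by positivity) (by positivity), ← sq]
  exact_mod_cast hJ.symm

theorem MulChar.eq_one_of_apply_eq_one_of_orderOf_eq {χ : MulChar F ℂ}
    (hχ : orderOf χ = Nat.card Fˣ) {u : Fˣ} (hu : χ u = 1) : u = 1 := by
  obtain ⟨g, hg⟩ := IsCyclic.exists_generator (α := Fˣ)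
  obtain ⟨m, rfl⟩ := (mem_powers_iff_mem_zpowers (x := g)).mpr (hg u)
  have : χ ^ m = 1 := by
    rw [MulChar.eq_iff hg, MulChar.pow_apply_coe, MulChar.one_apply_coe]
    simpa using hu
  rw [← orderOf_dvd_iff_pow_eq_one, hχ] at this
  exact orderOf_dvd_iff_pow_eq_one.mp ((orderOf_dvd_natCard g).trans this)

theorem range_powMonoidHom_eq_ker {G : Type*} [CommGroup G] [IsCyclic G] [Finite G] (k : ℕ) :
    (powMonoidHom k : G →* G).range =
      (powMonoidHom (Nat.card G / (Nat.card G).gcd k) : G →* G).ker := by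
  have hd := Nat.gcd_dvd_left (Nat.card G) k
  apply Subgroup.eq_of_le_of_card_ge
  · rintro _ ⟨x, rfl⟩
    rw [MonoidHom.mem_ker, powMonoidHom_apply, powMonoidHom_apply, ← pow_mul,
      ← orderOf_dvd_iff_pow_eq_one]
    refine (orderOf_dvd_natCard x).trans ?_
    conv_lhs => rw [← Nat.mul_div_cancel' hd]
    exact Nat.mul_dvd_mul_right (Nat.gcd_dvd_right _ _) _
  · rw [IsCyclic.card_powMonoidHom_range, IsCyclic.card_powMonoidHom_ker,
      Nat.gcd_eq_right (Nat.div_dvd_of_dvd hd)]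

theorem card_filter_pow_eq [DecidableEq F] {χ : MulChar F ℂ} (hχ : orderOf χ = Nat.card Fˣ)
    {k : ℕ} (hk : 0 < k) {d : ℕ} (hd : d = (Nat.card Fˣ).gcd k) (y : F) :
    (#{x : F | x ^ k = y} : ℂ) = 1 + ∑ j ∈ Icc 1 (d - 1), (χ ^ (Nat.card Fˣ / d * j)) y := by
  by_cases hy : y = 0
  · subst hy
    have : ({x : F | x ^ k = 0} : Finset F) = {0} := by
      ext x; simp [hk.ne']
    rw [this]
    simp [MulChar.map_zero]
  obtain ⟨u, rfl⟩ : ∃ u : Fˣ, (u : F) = y := ⟨Units.mk0 y hy, rfl⟩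
  have hd0 : 0 < d := hd ▸ Nat.gcd_pos_of_pos_right _ hk
  have hdn : d ∣ Nat.card Fˣ := hd ▸ Nat.gcd_dvd_left _ _
  have hcard : #{x : F | x ^ k = u} = Nat.card ((powMonoidHom k : Fˣ →* Fˣ) ⁻¹' {u}) := by
    rw [← Fintype.card_coe, ← Nat.card_eq_fintype_card]
    have hmem (v : (powMonoidHom k : Fˣ →* Fˣ) ⁻¹' {u}) :
        ((v : Fˣ) : F) ∈ ({x : F | x ^ k = u} : Finset F) := by
      have := v.2
      simp only [Set.mem_preimage, powMonoidHom_apply, Set.mem_singleton_iff] at this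
      simp [← this]
    refine (Nat.card_congr (Equiv.ofBijective (fun v => ⟨((v : Fˣ) : F), hmem v⟩) ⟨?_, ?_⟩)).symm
    · intro v w h
      exact Subtype.ext (Units.ext (congrArg Subtype.val h))
    · rintro ⟨x, hx⟩
      simp only [mem_filter, mem_univ, true_and] at hx
      have hx0 : x ≠ 0 := by
        rintro rfl
        rw [zero_pow hk.ne'] at hx
        exact u.ne_zero hx.symm
      refine ⟨⟨Units.mk0 x hx0, ?_⟩, rfl⟩
      simp [Units.ext_iff, hx]
  have hsum : 1 + ∑ j ∈ Icc 1 (d - 1), (χ ^ (Nat.card Fˣ / d * j)) u =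
      ∑ j ∈ range d, ((χ u) ^ (Nat.card Fˣ / d)) ^ j := by
    rw [Finset.range_eq_Ico, Finset.sum_eq_sum_Ico_succ_bot hd0, pow_zero]
    congr 1
    refine Finset.sum_congr ?_ fun j _ => by rw [MulChar.pow_apply_coe, pow_mul]
    ext j; simp only [mem_Icc, mem_Ico]; omega
  rw [hsum, hcard]
  by_cases hu : u ∈ (powMonoidHom k : Fˣ →* Fˣ).range
  · have h1 : (χ u) ^ (Nat.card Fˣ / d) = 1 := by
      rw [range_powMonoidHom_eq_ker, MonoidHom.mem_ker, powMonoidHom_apply, ← hd] at hu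
      rw [← map_pow, ← Units.val_pow_eq_pow_val, hu, Units.val_one, map_one]
    obtain ⟨v, rfl⟩ := hu
    rw [Nat.card_congr (MonoidHom.fiberEquivKer _ v), IsCyclic.card_powMonoidHom_ker, ← hd, h1]
    simp
  · have h1 : (χ u) ^ (Nat.card Fˣ / d) ≠ 1 := by
      rw [range_powMonoidHom_eq_ker, MonoidHom.mem_ker, powMonoidHom_apply, ← hd] at hu
      rw [← map_pow, ← Units.val_pow_eq_pow_val]
      exact fun h => hu (MulChar.eq_one_of_apply_eq_one_of_orderOf_eq hχ h)
    have h2 : ((χ u) ^ (Nat.card Fˣ / d)) ^ d = 1 := by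
      rw [← pow_mul, Nat.div_mul_cancel hdn, ← map_pow, ← Units.val_pow_eq_pow_val,
        pow_card_eq_one', Units.val_one, map_one]
    rw [geom_sum_eq h1, h2, sub_self, zero_div]
    have : (powMonoidHom k : Fˣ →* Fˣ) ⁻¹' {u} = ∅ :=
      Set.eq_empty_of_forall_notMem fun v hv => hu ⟨v, hv⟩
    simp [this]

theorem sum_mulChar_mul_mulChar_line (χ φ : MulChar F ℂ) {a₁ a₂ b : F} (ha₁ : a₁ ≠ 0)
    (ha₂ : a₂ ≠ 0) (hb : b ≠ 0) :
    ∑ y, χ y * φ ((b - a₁ * y) / a₂) = χ (b / a₁) * φ (b / a₂) * jacobiSum χ φ := by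
  rw [jacobiSum, Finset.mul_sum,
    ← (mulLeft_bijective₀ (b / a₁) (div_ne_zero hb ha₁)).sum_comp]
  refine Finset.sum_congr rfl fun y _ => ?_
  have : (b - a₁ * (b / a₁ * y)) / a₂ = b / a₂ * (1 - y) := by field_simp
  rw [this, map_mul, map_mul]
  ring

theorem sum_one_add_mul_one_add_line {ι κ : Type*} (s : Finset ι) (t : Finset κ)
    (χ : ι → MulChar F ℂ) (φ : κ → MulChar F ℂ) (hχ : ∀ i ∈ s, χ i ≠ 1) (hφ : ∀ j ∈ t, φ j ≠ 1)
    {a₁ a₂ b : F} (ha₁ : a₁ ≠ 0) (ha₂ : a₂ ≠ 0) (hb : b ≠ 0) :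
    ∑ y, (1 + ∑ i ∈ s, χ i y) * (1 + ∑ j ∈ t, φ j ((b - a₁ * y) / a₂)) =
      Fintype.card F + ∑ p ∈ s ×ˢ t,
        χ p.1 (b / a₁) * φ p.2 (b / a₂) * jacobiSum (χ p.1) (φ p.2) := by
  have hbij : Function.Bijective fun y : F => (b - a₁ * y) / a₂ := by
    refine Finite.injective_iff_bijective.mp fun x y h => ?_
    simpa [div_left_inj' ha₂, ha₁] using h
  have e1 : ∑ y, ∑ i ∈ s, χ i y = 0 := by
    rw [Finset.sum_comm]
    exact Finset.sum_eq_zero fun i hi => MulChar.sum_eq_zero_of_ne_one (hχ i hi)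
  have e2 : ∑ y, ∑ j ∈ t, φ j ((b - a₁ * y) / a₂) = 0 := by
    rw [Finset.sum_comm]
    refine Finset.sum_eq_zero fun j hj => ?_
    rw [hbij.sum_comp (fun y => φ j y)]
    exact MulChar.sum_eq_zero_of_ne_one (hφ j hj)
  have e3 : ∑ y, (∑ i ∈ s, χ i y) * ∑ j ∈ t, φ j ((b - a₁ * y) / a₂) =
      ∑ p ∈ s ×ˢ t, χ p.1 (b / a₁) * φ p.2 (b / a₂) * jacobiSum (χ p.1) (φ p.2) := by
    simp only [Finset.sum_mul_sum]
    simp only [← Finset.sum_product' (s := s)]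
    rw [Finset.sum_comm]
    exact Finset.sum_congr rfl fun p _ => sum_mulChar_mul_mulChar_line _ _ ha₁ ha₂ hb
  simp only [add_mul, mul_add, one_mul, mul_one, Finset.sum_add_distrib, e1, e2, e3]
  simp

theorem card_diagonal_solutions [DecidableEq F] {a₁ a₂ b : F} (ha₂ : a₂ ≠ 0) (k₁ k₂ : ℕ) :
    Nat.card {x : F × F // a₁ * x.1 ^ k₁ + a₂ * x.2 ^ k₂ = b} =
      ∑ y : F, #{x : F | x ^ k₁ = y} * #{x : F | x ^ k₂ = (b - a₁ * y) / a₂} := by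
  rw [Nat.card_eq_fintype_card, Fintype.card_subtype,
    Finset.card_eq_sum_card_fiberwise (f := fun x => x.1 ^ k₁) (t := univ) (by simp)]
  refine Finset.sum_congr rfl fun y _ => ?_
  rw [← Finset.card_product]
  congr 1
  ext ⟨x₁, x₂⟩
  simp only [mem_filter, mem_univ, true_and, mem_product]
  rw [and_comm, and_congr_right_iff]
  rintro rfl
  rw [eq_div_iff ha₂, eq_sub_iff_add_eq']
  rw [mul_comm a₂]

end CharacterSums

theorem dvd_div_mul_add_div_mul_iff {n d₁ d₂ : ℕ} (hn : n ≠ 0) (h₁ : d₁ ∣ n) (h₂ : d₂ ∣ n)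
    (i j : ℕ) :
    n ∣ n / d₁ * i + n / d₂ * j ↔ ∃ z : ℤ, (i : ℚ) / d₁ + (j : ℚ) / d₂ = z := by
  have hn' : (n : ℚ) ≠ 0 := by exact_mod_cast hn
  have hcast : ((n / d₁ * i + n / d₂ * j : ℕ) : ℚ) = n * ((i : ℚ) / d₁ + (j : ℚ) / d₂) := by
    push_cast [Nat.cast_div_charZero h₁, Nat.cast_div_charZero h₂]
    ring
  rw [← Int.natCast_dvd_natCast]
  generalize n / d₁ * i + n / d₂ * j = m at hcast ⊢
  constructor
  · rintro ⟨z, hz⟩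
    refine ⟨z, mul_left_cancel₀ hn' ?_⟩
    rw [← hcast]
    exact_mod_cast hz
  · rintro ⟨z, hz⟩
    rw [hz] at hcast
    exact ⟨z, by exact_mod_cast hcast⟩

theorem MulChar.pow_div_mul_ne_one {F : Type*} [Field F] [Fintype F] {χ : MulChar F ℂ} {d j : ℕ}
    (hd : d ∣ orderOf χ) (hj : j ∈ Icc 1 (d - 1)) :
    χ ^ (orderOf χ / d * j) ≠ 1 := by
  obtain ⟨hj1, hj2⟩ := mem_Icc.mp hj
  obtain ⟨m, hm⟩ := hd
  have hpos := χ.orderOf_pos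
  have hd0 : 0 < d := by omega
  intro h
  rw [← orderOf_dvd_iff_pow_eq_one, hm, Nat.mul_div_cancel_left _ hd0, mul_comm d] at h
  have hm0 : 0 < m := Nat.pos_of_ne_zero fun h0 => by simp [hm, h0] at hpos
  have := Nat.le_of_dvd hj1 (Nat.dvd_of_mul_dvd_mul_left hm0 h)
  omega


/-- Weil bound for the number of solutions of a diagonal equation `a₁ x₁^{k₁} + a₂ x₂^{k₂} = b`
over the finite field `F_q`:
`|N − q| ≤ [(d₁ − 1)(d₂ − 1) − (1 − q^{−1/2}) M(d₁, d₂)] q^{1/2}`, where `dᵢ = gcd(kᵢ, q − 1)`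
and `M(d₁, d₂)` is the number of pairs `(j₁, j₂)` of integers with `1 ≤ jᵢ ≤ dᵢ − 1` and
`j₁/d₁ + j₂/d₂ ∈ ℤ`. -/
theorem stmt12 {F : Type*} [Field F] [Fintype F] (q : ℕ) (hq : Fintype.card F = q)
    (a₁ a₂ b : F) (ha₁ : a₁ ≠ 0) (ha₂ : a₂ ≠ 0) (hb : b ≠ 0)
    (k₁ k₂ : ℕ) (hk₁ : 0 < k₁) (hk₂ : 0 < k₂)
    (d₁ d₂ : ℕ) (hd₁ : d₁ = Nat.gcd k₁ (q - 1)) (hd₂ : d₂ = Nat.gcd k₂ (q - 1))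
    (N : ℕ) (hN : N = Nat.card {x : F × F // a₁ * x.1 ^ k₁ + a₂ * x.2 ^ k₂ = b})
    (M : ℕ) (hM : M = Nat.card {jj : ℕ × ℕ // 1 ≤ jj.1 ∧ jj.1 ≤ d₁ - 1 ∧ 1 ≤ jj.2 ∧
      jj.2 ≤ d₂ - 1 ∧ ∃ z : ℤ, (jj.1 : ℚ) / d₁ + (jj.2 : ℚ) / d₂ = (z : ℚ)}) :
    |(N : ℝ) - q| ≤
      (((d₁ : ℝ) - 1) * ((d₂ : ℝ) - 1) - (1 - (Real.sqrt q)⁻¹) * M) * Real.sqrt q := by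
  classical
  subst hq hN
  have hn : Nat.card Fˣ = Fintype.card F - 1 := by
    rw [Nat.card_eq_fintype_card, Fintype.card_units]
  have hn0 : Nat.card Fˣ ≠ 0 := Nat.card_pos.ne'
  rw [← hn, Nat.gcd_comm] at hd₁ hd₂
  have hdn₁ : d₁ ∣ Nat.card Fˣ := hd₁ ▸ Nat.gcd_dvd_left _ _
  have hdn₂ : d₂ ∣ Nat.card Fˣ := hd₂ ▸ Nat.gcd_dvd_left _ _
  have hpos₁ : 0 < d₁ := Nat.pos_of_dvd_of_pos hdn₁ Nat.card_pos
  have hpos₂ : 0 < d₂ := Nat.pos_of_dvd_of_pos hdn₂ Nat.card_pos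
  obtain ⟨χ, hχ⟩ : ∃ χ : MulChar F ℂ, orderOf χ = Nat.card Fˣ :=
    MulChar.exists_mulChar_orderOf F (by rw [hn]) (Complex.isPrimitiveRoot_exp _ hn0)
  have hne₁ : ∀ j ∈ Icc 1 (d₁ - 1), χ ^ (Nat.card Fˣ / d₁ * j) ≠ 1 := fun j hj => by
    rw [← hχ] at hdn₁ ⊢
    exact MulChar.pow_div_mul_ne_one hdn₁ hj
  have hne₂ : ∀ j ∈ Icc 1 (d₂ - 1), χ ^ (Nat.card Fˣ / d₂ * j) ≠ 1 := fun j hj => by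
    rw [← hχ] at hdn₂ ⊢
    exact MulChar.pow_div_mul_ne_one hdn₂ hj
  have hcount := congrArg (Nat.cast : ℕ → ℂ)
    (card_diagonal_solutions (a₁ := a₁) (b := b) ha₂ k₁ k₂)
  push_cast at hcount
  simp only [card_filter_pow_eq hχ hk₁ hd₁, card_filter_pow_eq hχ hk₂ hd₂] at hcount
  rw [sum_one_add_mul_one_add_line (Icc 1 (d₁ - 1)) (Icc 1 (d₂ - 1))
    (fun j => χ ^ (Nat.card Fˣ / d₁ * j)) (fun j => χ ^ (Nat.card Fˣ / d₂ * j))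
    hne₁ hne₂ ha₁ ha₂ hb, ← sub_eq_iff_eq_add'] at hcount
  set P := Icc 1 (d₁ - 1) ×ˢ Icc 1 (d₂ - 1) with hP
  let c : ℕ × ℕ → Prop := fun p => ∃ z : ℤ, (p.1 : ℚ) / d₁ + (p.2 : ℚ) / d₂ = z
  have hM' : M = #{p ∈ P | c p} := by
    rw [hM, ← Fintype.card_coe, ← Nat.card_eq_fintype_card]
    refine Nat.card_congr (Equiv.subtypeEquivRight fun p => ?_)
    simp only [hP, c, mem_filter, mem_product, mem_Icc]
    tauto
  have hterm : ∀ p ∈ P, ‖(χ ^ (Nat.card Fˣ / d₁ * p.1)) (b / a₁) *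
      (χ ^ (Nat.card Fˣ / d₂ * p.2)) (b / a₂) *
      jacobiSum (χ ^ (Nat.card Fˣ / d₁ * p.1)) (χ ^ (Nat.card Fˣ / d₂ * p.2))‖ ≤
      if c p then 1 else √(Fintype.card F) := by
    intro p hp
    obtain ⟨hp₁, hp₂⟩ := mem_product.mp hp
    have hiff : χ ^ (Nat.card Fˣ / d₁ * p.1) * χ ^ (Nat.card Fˣ / d₂ * p.2) = 1 ↔ c p := by
      rw [← pow_add, ← orderOf_dvd_iff_pow_eq_one, hχ,
        dvd_div_mul_add_div_mul_iff hn0 hdn₁ hdn₂]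
    rw [norm_mul, norm_mul]
    refine (mul_le_of_le_one_left (norm_nonneg _) (mul_le_one₀ (norm_mulChar_le_one _ _)
      (norm_nonneg _) (norm_mulChar_le_one _ _))).trans ?_
    split_ifs with h
    · exact norm_jacobiSum_inv_le_one (hne₁ _ hp₁) (hiff.mpr h)
    · exact (norm_jacobiSum (hne₁ _ hp₁) (hne₂ _ hp₂) (mt hiff.mp h)).le
  have hbound := norm_sum_le_of_le P hterm
  rw [← hcount, Finset.sum_ite, Finset.sum_const, Finset.sum_const, ← hM'] at hbound
  have hcardP : (#{p ∈ P | c p} : ℝ) + #{p ∈ P | ¬ c p} = (d₁ - 1) * (d₂ - 1) := by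
    have := Finset.card_filter_add_card_filter_not (s := P) c
    rw [hP, Finset.card_product, Nat.card_Icc, Nat.card_Icc, Nat.add_sub_cancel,
      Nat.add_sub_cancel] at this
    rw [← Nat.cast_pred hpos₁, ← Nat.cast_pred hpos₂]
    exact_mod_cast this
  rw [← hM', ← eq_sub_iff_add_eq'] at hcardP
  rw [nsmul_eq_mul, nsmul_eq_mul, hcardP, mul_one] at hbound
  have hsq : √(Fintype.card F : ℝ) ≠ 0 := by
    have : 0 < Fintype.card F := Fintype.card_pos
    positivity
  calc _ = ‖((Nat.card {x : F × F // a₁ * x.1 ^ k₁ + a₂ * x.2 ^ k₂ = b} : ℂ)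
        - Fintype.card F)‖ := by
        rw [← Real.norm_eq_abs, ← Complex.norm_real]
        push_cast
        rfl
    _ ≤ _ := hbound
    _ = _ := by field_simp; ring
end
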